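/- CNT3 is not invariant under consistification: if b is a contextual cyclic system of rank n ≥ 2 and b‡ is its consistification (a cyclic system of rank 2n), then CNT3(b‡) = ((n − 1)/(2n − 1)) · CNT3(b). -/

import Mathlib

open Finset

/-- Cyclic predecessor `i ⊖ 1` on `Fin n`. -/
def fpred {n : ℕ} (i : Fin n) : Fin n := ⟨(i.val + (n - 1)) % n, Nat.mod_lt _ i.pos⟩

/-- Cyclic successor `i ⊕ 1` on `Fin n`. -/
def fsucc {n : ℕ} (i : Fin n) : Fin n := ⟨(i.val + 1) % n, Nat.mod_lt _ i.pos⟩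

/-- `b` specifies a cyclic system of rank `n`: each bunch distribution is
nonnegative and sums to one. -/
def IsCyclicSystem (n : ℕ) (b : Fin n → Bool → Bool → ℝ) : Prop :=
  (∀ i r r', 0 ≤ b i r r') ∧ ∀ i, (∑ r : Bool, ∑ r' : Bool, b i r r') = 1

/-- Marginal distribution of `R_i^i`. -/
def mFst {n : ℕ} (b : Fin n → Bool → Bool → ℝ) (i : Fin n) (r : Bool) : ℝ :=
  b i r false + b i r true

/-- Marginal distribution of `R_i^{i⊖1}`. -/
def mSnd {n : ℕ} (b : Fin n → Bool → Bool → ℝ) (i : Fin n) (r : Bool) : ℝ :=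
  b (fpred i) false r + b (fpred i) true r

/-- Multimaximal-coupling distribution of connection `i`:
joint distribution of `(T_i^i, T_i^{i⊖1})`. -/
noncomputable def mmc {n : ℕ} (b : Fin n → Bool → Bool → ℝ) (i : Fin n) : Bool → Bool → ℝ :=
  fun r r' =>
    match r, r' with
    | true, true => min (mFst b i true) (mSnd b i true)
    | false, false => min (mFst b i false) (mSnd b i false)
    | true, false => mFst b i true - min (mFst b i true) (mSnd b i true)
    | false, true => mSnd b i true - min (mFst b i true) (mSnd b i true)

/-- Bunch marginal of a signed quasi-coupling `y` at context `i`. -/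
def Bm {n : ℕ} (i : Fin n) (y : (Fin n → Bool × Bool) → ℝ) (r r' : Bool) : ℝ :=
  ∑ s : Fin n → Bool × Bool, if s i = (r, r') then y s else 0

/-- Connection marginal of a signed quasi-coupling `y` at content `i`. -/
def Cm {n : ℕ} (i : Fin n) (y : (Fin n → Bool × Bool) → ℝ) (r r' : Bool) : ℝ :=
  ∑ s : Fin n → Bool × Bool, if (s i).1 = r ∧ (s (fpred i)).2 = r' then y s else 0

/-- `y` is a feasible signed quasi-coupling for the system `b`. -/
def Feasible {n : ℕ} (b : Fin n → Bool → Bool → ℝ) (y : (Fin n → Bool × Bool) → ℝ) : Prop :=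
  ∀ i r r', Bm i y r r' = b i r r' ∧ Cm i y r r' = mmc b i r r'

/-- The quasi-coupling measure of contextuality. -/
noncomputable def CNT3 {n : ℕ} (b : Fin n → Bool → Bool → ℝ) : ℝ :=
  sInf {t : ℝ | ∃ y, Feasible b y ∧ t = ∑ s : Fin n → Bool × Bool, |y s|} - 1

/-- Constraints of the contextual-fraction linear program. -/
def CNTFConstraints {n : ℕ} (b : Fin n → Bool → Bool → ℝ)
    (z : (Fin n → Bool × Bool) → ℝ) : Prop :=
  (∀ s, 0 ≤ z s) ∧ ∀ i r r', Bm i z r r' ≤ b i r r' ∧ Cm i z r r' ≤ mmc b i r r'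

/-- The contextual fraction. -/
noncomputable def CNTF {n : ℕ} (b : Fin n → Bool → Bool → ℝ) : ℝ :=
  1 - sSup {t : ℝ | ∃ z, CNTFConstraints b z ∧ t = ∑ s : Fin n → Bool × Bool, z s}

/-- `b` is noncontextual iff it admits a nonnegative feasible coupling. -/
def Noncontextual {n : ℕ} (b : Fin n → Bool → Bool → ℝ) : Prop :=
  ∃ y, Feasible b y ∧ ∀ s, 0 ≤ y s

/-- The consistification of a cyclic system of rank `n`: a cyclic system of rank `2n`
whose even-indexed bunches are the original bunches and whose odd-indexed bunch `2i+1`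
is the joint distribution of the multimaximal coupling `(T_{i⊕1}^i, T_{i⊕1}^{i⊕1})`
of connection `i⊕1`. -/
noncomputable def consistify (n : ℕ) (b : Fin n → Bool → Bool → ℝ) :
    Fin (2 * n) → Bool → Bool → ℝ :=
  fun j r r' =>
    if j.val % 2 = 0 then b ⟨j.val / 2, by have := j.isLt; omega⟩ r r'
    else mmc b (fsucc ⟨j.val / 2, by have := j.isLt; omega⟩) r' r

section CyclicCoupling

/-- The sign character of `Bool`, turning `xor` into multiplication. -/
def sgn (r : Bool) : ℝ := if r then -1 else 1

@[simp] lemma sgn_true : sgn true = -1 := rfl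

@[simp] lemma sgn_false : sgn false = 1 := by simp [sgn]

lemma sgn_xor (a b : Bool) : sgn (xor a b) = sgn a * sgn b := by
  cases a <;> cases b <;> simp

@[simp] lemma sgn_mul_self (a : Bool) : sgn a * sgn a = 1 := by cases a <;> simp

lemma sgn_ne_zero (a : Bool) : sgn a ≠ 0 := by cases a <;> simp

lemma fsucc_val {n : ℕ} (i : Fin n) :
    (fsucc i).val = if i.val + 1 = n then 0 else i.val + 1 := by
  have := i.isLt
  split_ifs with h
  · simp [fsucc, h]
  · exact Nat.mod_eq_of_lt (by omega)

lemma fpred_val {n : ℕ} (i : Fin n) :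
    (fpred i).val = if i.val = 0 then n - 1 else i.val - 1 := by
  have := i.isLt
  split_ifs with h
  · simp only [fpred, h, Nat.zero_add]
    exact Nat.mod_eq_of_lt (by omega)
  · have e : i.val + (n - 1) = (i.val - 1) + n := by omega
    simp only [fpred, e, Nat.add_mod_right]
    exact Nat.mod_eq_of_lt (by omega)

@[simp] lemma fsucc_fpred {n : ℕ} (i : Fin n) : fsucc (fpred i) = i := by
  have := i.isLt
  ext
  rw [fsucc_val, fpred_val]
  by_cases h : i.val = 0
  · rw [if_pos h, if_pos (by omega), h]
  · rw [if_neg h, if_neg (by omega)]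
    omega

@[simp] lemma fpred_fsucc {n : ℕ} (i : Fin n) : fpred (fsucc i) = i := by
  have := i.isLt
  ext
  rw [fpred_val, fsucc_val]
  by_cases h : i.val + 1 = n
  · rw [if_pos h, if_pos rfl]
    omega
  · rw [if_neg h, if_neg (by omega)]
    omega

/-- The cyclic successor as a permutation. -/
def fsuccEquiv (n : ℕ) : Fin n ≃ Fin n := ⟨fsucc, fpred, fpred_fsucc, fsucc_fpred⟩

lemma prod_fsucc {n : ℕ} (f : Fin n → ℝ) : ∏ j, f (fsucc j) = ∏ j, f j :=
  Equiv.prod_comp (fsuccEquiv n) f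

/-- `w` is a signed measure of total mass one on the outcomes of the nodes of the `N`-cycle,
with node expectations `M` and edge correlations `C`. -/
def HasMoments {N : ℕ} (M C : Fin N → ℝ) (w : (Fin N → Bool) → ℝ) : Prop :=
  ∑ x, w x = 1 ∧ (∀ j, ∑ x, w x * sgn (x j) = M j) ∧
    ∀ j, ∑ x, w x * (sgn (x j) * sgn (x (fsucc j))) = C j

/-- Four times the probability of the outcome `(r, r')` at the edge `j`. -/
def edgeForm {N : ℕ} (M C : Fin N → ℝ) (j : Fin N) (r r' : Bool) : ℝ :=
  1 + sgn r * M j + sgn r' * M (fsucc j) + sgn r * sgn r' * C j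

/-- The moments `M`, `C` define a probability distribution on every edge. -/
def EdgePositive {N : ℕ} (M C : Fin N → ℝ) : Prop := ∀ j r s, 0 ≤ edgeForm M C j r s

/-- Expected number of edges whose correlation differs from the sign pattern `σ`. -/
noncomputable def defect {N : ℕ} (C : Fin N → ℝ) (σ : Fin N → Bool) : ℝ :=
  ∑ j, (1 - sgn (σ j) * C j) / 2

/-- Sign patterns that no assignment of the nodes realizes. -/
def OddPattern {N : ℕ} (σ : Fin N → Bool) : Prop := ∏ j, sgn (σ j) = -1

lemma abs_sum_le_of_prod_eq_neg_one {N : ℕ} (hN : Even N) (z : Fin N → ℝ)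
    (hz : ∀ j, z j = 1 ∨ z j = -1) (hp : ∏ j, z j = -1) : |∑ j, z j| ≤ (N : ℝ) - 2 := by
  obtain ⟨j, hj⟩ : ∃ j, z j = -1 := by
    by_contra! h
    have : ∏ j, z j = 1 := prod_eq_one fun j _ => (hz j).resolve_right (h j)
    linarith
  obtain ⟨k, hk⟩ : ∃ k, z k = 1 := by
    by_contra! h
    have : ∏ j, z j = 1 := by
      rw [prod_congr rfl fun j _ => (hz j).resolve_left (h j)]
      simp [hN.neg_one_pow]
    linarith
  have h1 : 1 - z j ≤ ∑ i, (1 - z i) :=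
    single_le_sum (f := fun i => 1 - z i)
      (fun i _ => by rcases hz i with h | h <;> simp [h]) (mem_univ j)
  have h2 : 1 + z k ≤ ∑ i, (1 + z i) :=
    single_le_sum (f := fun i => 1 + z i)
      (fun i _ => by rcases hz i with h | h <;> simp [h]) (mem_univ k)
  simp only [sum_sub_distrib, sum_add_distrib, sum_const, card_univ, Fintype.card_fin,
    nsmul_eq_mul, mul_one] at h1 h2
  rw [abs_le]
  constructor <;> linarith

/-- The Bell-type bound on the total variation of a signed coupling. -/
lemma HasMoments.le_sum_abs {N : ℕ} (hN : Even N) {M C : Fin N → ℝ} {w : (Fin N → Bool) → ℝ}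
    (hw : HasMoments M C w) {σ : Fin N → Bool} (hσ : OddPattern σ) :
    (N : ℝ) - 2 * defect C σ ≤ ((N : ℝ) - 2) * ∑ x, |w x| := by
  have e : (N : ℝ) - 2 * defect C σ
      = ∑ x, w x * ∑ j, sgn (σ j) * (sgn (x j) * sgn (x (fsucc j))) := by
    have : ∀ j, sgn (σ j) * C j
        = ∑ x, w x * (sgn (σ j) * (sgn (x j) * sgn (x (fsucc j)))) := fun j => by
      rw [← hw.2.2 j, mul_sum]
      exact sum_congr rfl fun x _ => by ring
    simp only [mul_sum]
    rw [sum_comm, ← sum_congr rfl fun j _ => this j]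
    simp only [defect, ← sum_div, sum_sub_distrib, sum_const, card_univ, Fintype.card_fin,
      nsmul_eq_mul, mul_one]
    ring
  rw [e, mul_sum]
  refine sum_le_sum fun x _ => ?_
  have h := abs_sum_le_of_prod_eq_neg_one hN
    (fun j => sgn (σ j) * (sgn (x j) * sgn (x (fsucc j))))
    (fun j => by cases σ j <;> cases x j <;> cases x (fsucc j) <;> simp)
    (by
      rw [prod_mul_distrib, prod_mul_distrib, prod_fsucc (fun j => sgn (x j)), ← prod_mul_distrib]
      simpa [OddPattern] using hσ)
  calc _ ≤ |w x * ∑ j, sgn (σ j) * (sgn (x j) * sgn (x (fsucc j)))| := le_abs_self _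
    _ = |∑ j, sgn (σ j) * (sgn (x j) * sgn (x (fsucc j)))| * |w x| := by rw [abs_mul, mul_comm]
    _ ≤ _ := mul_le_mul_of_nonneg_right h (abs_nonneg _)

/-- A potential for a sign pattern along the path `0, 1, …, N`. -/
lemma exists_potential {N : ℕ} (σ : Fin N → Bool) :
    ∃ θ : ℕ → Bool, θ 0 = false ∧ (∀ j : Fin N, θ (j + 1) = xor (θ j) (σ j)) ∧
      sgn (θ N) = ∏ j, sgn (σ j) := by
  let τ : ℕ → Bool := fun k => if h : k < N then σ ⟨k, h⟩ else false
  let θ : ℕ → Bool := fun k => Nat.rec false (fun k t => xor t (τ k)) k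
  have hτ : ∀ j : Fin N, τ j = σ j := fun j => by simp [τ]
  have hprod : ∀ K, sgn (θ K) = ∏ k ∈ range K, sgn (τ k) := by
    intro K
    induction K with
    | zero => simp [θ]
    | succ K ih => rw [prod_range_succ, ← ih, ← sgn_xor]
  refine ⟨θ, rfl, fun j => by rw [← hτ], ?_⟩
  rw [hprod, ← Fin.prod_univ_eq_prod_range (fun k => sgn (τ k))]
  simp [hτ]

lemma sum_telescope_flip (g : ℕ → ℝ) (j K : ℕ) :
    ∑ k ∈ range K, (g k - g (k + 1)) / 2 * (if k < j then -1 else 1)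
      = if K ≤ j then (g K - g 0) / 2 else g j - (g 0 + g K) / 2 := by
  induction K with
  | zero => simp
  | succ K ih =>
    rw [sum_range_succ, ih]
    rcases lt_trichotomy K j with h | h | h
    · rw [if_pos h.le, if_pos h, if_pos (by omega)]; ring
    · subst h
      rw [if_pos le_rfl, if_neg (lt_irrefl _), if_neg (by omega)]; ring
    · rw [if_neg (by omega), if_neg (by omega), if_neg (by omega)]; ring

/-- Sums against a finite combination of point masses. -/
lemma sum_pointMass_mul {ι X : Type*} [Fintype ι] [Fintype X] [DecidableEq X]
    (c : ι → ℝ) (p : ι → X) (f : X → ℝ) :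
    ∑ x, (∑ i, if x = p i then c i else 0) * f x = ∑ i, c i * f (p i) := by
  simp only [sum_mul, ite_mul, zero_mul]
  rw [sum_comm]
  simp

lemma sum_abs_pointMass_le {ι X : Type*} [Fintype ι] [Fintype X] [DecidableEq X]
    (c : ι → ℝ) (p : ι → X) :
    ∑ x, |∑ i, if x = p i then c i else 0| ≤ ∑ i, |c i| := by
  calc _ ≤ ∑ x, ∑ i, |if x = p i then c i else 0| :=
        sum_le_sum fun x _ => abs_sum_le_sum_abs _ _
    _ = ∑ i, |c i| := by
      rw [sum_comm]
      refine sum_congr rfl fun i _ => ?_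
      rw [sum_eq_single (p i)] <;> simp +contextual

/-- A signed coupling attaining the Bell-type bound. Its positive part lives on the assignments
with exactly one edge against `σ`, its negative part on those with all edges but one
against `σ`. -/
lemma exists_hasMoments_sum_abs_le {N : ℕ} (hN : Even N) (hN4 : 4 ≤ N) {M C : Fin N → ℝ}
    (hQ : EdgePositive M C) {σ : Fin N → Bool} (hσ : OddPattern σ) (hd : defect C σ ≤ 1) :
    ∃ w, HasMoments M C w ∧ ∑ x, |w x| ≤ 1 + 2 * (1 - defect C σ) / ((N : ℝ) - 2) := by
  obtain ⟨θ, hθ0, hθs, hθN⟩ := exists_potential σ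
  have hNR : (4 : ℝ) ≤ N := by exact_mod_cast hN4
  have hN0 : 0 < N := by omega
  set m : ℝ := (1 - defect C σ) / ((N : ℝ) - 2) with hm
  have hm0 : 0 ≤ m := div_nonneg (by linarith) (by linarith)
  have hmN : m * ((N : ℝ) - 2) = 1 - defect C σ := div_mul_cancel₀ _ (by linarith)
  let g : ℕ → ℝ := fun k => sgn (θ k) * M ⟨k % N, Nat.mod_lt _ hN0⟩
  have hg : ∀ j : Fin N, g j = sgn (θ j) * M j := fun j => by
    simp [g, Nat.mod_eq_of_lt j.isLt]
  have hg1 : ∀ j : Fin N, g (j + 1) = sgn (θ j) * sgn (σ j) * M (fsucc j) := fun j => by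
    simp only [g, hθs, sgn_xor]; rfl
  have hgN : g N = - g 0 := by
    simp only [g, hθN, Nat.mod_self, Nat.zero_mod, hθ0]
    rw [hσ]; simp
  let d : Fin N → ℝ := fun k => (1 - sgn (σ k) * C k) / 2
  let a : Fin N → ℝ := fun k => d k + m - if k.val + 1 = N then m else 0
  let B : Fin N → ℝ := fun k => (g k - g (k + 1)) / 2
  have hdB : ∀ k, |B k| ≤ d k := fun k => by
    have h1 := hQ k true true
    have h2 := hQ k true false
    have h3 := hQ k false true
    have h4 := hQ k false false
    simp only [edgeForm, sgn_true, sgn_false] at h1 h2 h3 h4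
    simp only [B, d, hg, hg1, abs_le]
    cases θ k <;> cases σ k <;> simp only [sgn_true, sgn_false] <;> constructor <;> linarith
  have haB : ∀ k, |B k| ≤ a k := fun k => by
    have := hdB k
    simp only [a]
    split_ifs <;> linarith
  have hlast : ∑ k : Fin N, (if k.val + 1 = N then m else 0) = m := by
    rw [sum_eq_single (⟨N - 1, by omega⟩ : Fin N)]
    · simp; omega
    · intro k _ hk
      refine if_neg fun h => hk (Fin.ext ?_)
      simp; omega
    · simp
  have hsa : ∑ k, a k = 1 + m := by
    simp only [a, sum_sub_distrib, sum_add_distrib, hlast]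
    have : ∑ k, d k = defect C σ := rfl
    rw [this]
    simp
    linarith
  let c : (Fin N × Bool) ⊕ Bool → ℝ :=
    Sum.elim (fun kv => (a kv.1 + sgn kv.2 * B kv.1) / 2) (fun _ => -(m / 2))
  let p : (Fin N × Bool) ⊕ Bool → Fin N → Bool :=
    Sum.elim (fun kv j => xor (xor (θ j) kv.2) (decide (kv.1 < j)))
      (fun v j => xor (xor (θ j) v) (decide (Odd j.val)))
  have hsum : ∀ f : (Fin N → Bool) → ℝ, ∑ i, c i * f (p i)
      = ∑ k, ((a k + B k) / 2 * f (p (.inl (k, false))) + (a k - B k) / 2 * f (p (.inl (k, true))))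
        - m / 2 * (f (p (.inr false)) + f (p (.inr true))) := fun f => by
    simp only [Fintype.sum_sum_type, Fintype.sum_prod_type, Fintype.sum_bool, c, Sum.elim_inl,
      Sum.elim_inr, sgn_true, sgn_false]
    rw [sub_eq_add_neg]
    congr 1
    · exact sum_congr rfl fun k _ => by ring
    · ring
  have hpl : ∀ k v j, sgn (p (.inl (k, v)) j)
      = sgn (θ j) * sgn v * (if k < j then -1 else 1) := fun k v j => by
    simp only [p, Sum.elim_inl, sgn_xor]
    split_ifs with h <;> simp [h]
  have hpr : ∀ v j, sgn (p (.inr v) j)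
      = sgn (θ j) * sgn v * (if Odd j.val then -1 else 1) := fun v j => by
    simp only [p, Sum.elim_inr, sgn_xor]
    split_ifs with h <;> simp [h]
  have hedge : ∀ (j : Fin N) (v : Bool) (P : Fin N → Prop) [DecidablePred P],
      sgn (θ j) * sgn v * (if P j then -1 else 1)
        * (sgn (θ (fsucc j)) * sgn v * (if P (fsucc j) then -1 else 1))
      = sgn (σ j) * ((if P j then -1 else 1) * (if P (fsucc j) then -1 else 1)
        * (if j.val + 1 = N then -1 else 1)) := by
    intro j v P _
    have key : sgn (θ j) * sgn (θ (fsucc j)) = sgn (σ j) * (if j.val + 1 = N then -1 else 1) := by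
      rw [fsucc_val]
      split_ifs with h
      · have := hθs j
        rw [h] at this
        have h2 : sgn (θ N) = -1 := by rw [hθN]; exact hσ
        rw [this, sgn_xor] at h2
        rw [hθ0]
        revert h2
        cases θ j <;> cases σ j <;> simp
        norm_num
      · rw [hθs j, sgn_xor, ← mul_assoc]; simp
    have hv := sgn_mul_self v
    linear_combination (if P j then -1 else 1) * (if P (fsucc j) then -1 else 1)
      * (sgn (θ j) * sgn (θ (fsucc j)) * hv + key)
  have hel : ∀ k v j, sgn (p (.inl (k, v)) j) * sgn (p (.inl (k, v)) (fsucc j))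
      = sgn (σ j) * (if k = j then -1 else 1) := fun k v j => by
    rw [hpl, hpl, hedge j v (fun i => k < i)]
    congr 1
    have := k.isLt
    have := j.isLt
    simp only [Fin.lt_def, fsucc_val, Fin.ext_iff]
    split_ifs <;> first | contradiction | omega | norm_num
  have her : ∀ v j, sgn (p (.inr v) j) * sgn (p (.inr v) (fsucc j))
      = sgn (σ j) * (if j.val + 1 = N then 1 else -1) := fun v j => by
    rw [hpr, hpr, hedge j v (fun i => Odd i.val)]
    congr 1
    have := j.isLt
    simp only [fsucc_val, Nat.odd_iff]
    rw [Nat.even_iff] at hN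
    split_ifs <;> first | contradiction | omega | norm_num
  refine ⟨fun x => ∑ i, if x = p i then c i else 0, ⟨?_, fun j => ?_, fun j => ?_⟩, ?_⟩
  · have := sum_pointMass_mul c p (fun _ => 1)
    simp only [mul_one] at this
    rw [this]
    have := hsum fun _ => 1
    simp only [mul_one] at this
    rw [this]
    have e : ∀ k, (a k + B k) / 2 + (a k - B k) / 2 = a k := fun k => by ring
    simp only [e, hsa]
    ring
  · rw [sum_pointMass_mul c p (fun x => sgn (x j)), hsum fun x => sgn (x j)]
    simp only [hpl, hpr, sgn_true, sgn_false]
    have e : ∀ k : Fin N, (a k + B k) / 2 * (sgn (θ j) * 1 * (if k < j then -1 else 1))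
        + (a k - B k) / 2 * (sgn (θ j) * -1 * (if k < j then -1 else 1))
        = sgn (θ j) * ((g k - g (k + 1)) / 2 * (if k.val < j.val then -1 else 1)) := fun k => by
      simp only [B, Fin.lt_def]
      ring
    simp only [e, ← mul_sum]
    rw [Fin.sum_univ_eq_sum_range
      (fun k => (g k - g (k + 1)) / 2 * (if k < j.val then (-1 : ℝ) else 1)),
      sum_telescope_flip, if_neg (by have := j.isLt; omega), hgN, hg]
    linear_combination M j * sgn_mul_self (θ j)
  · rw [sum_pointMass_mul c p (fun x => sgn (x j) * sgn (x (fsucc j))),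
      hsum fun x => sgn (x j) * sgn (x (fsucc j))]
    simp only [hel, her]
    have e : ∀ k : Fin N, (a k + B k) / 2 * (sgn (σ j) * (if k = j then -1 else 1))
        + (a k - B k) / 2 * (sgn (σ j) * (if k = j then -1 else 1))
        = sgn (σ j) * (a k - 2 * (if k = j then a k else 0)) := fun k => by
      split_ifs <;> ring
    simp only [e, ← mul_sum, sum_sub_distrib, hsa, sum_ite_eq', mem_univ, if_true]
    simp only [a, d]
    have := sgn_mul_self (σ j)
    split_ifs <;> linear_combination C j * this
  · refine (sum_abs_pointMass_le c p).trans (le_of_eq ?_)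
    simp only [Fintype.sum_sum_type, Fintype.sum_prod_type, Fintype.sum_bool, c, Sum.elim_inl,
      Sum.elim_inr, sgn_true, sgn_false]
    have e : ∀ k, |(a k + -1 * B k) / 2| + |(a k + 1 * B k) / 2| = a k := fun k => by
      have := abs_le.1 (haB k)
      rw [abs_of_nonneg (by linarith), abs_of_nonneg (by linarith)]
      ring
    simp only [e, hsa, abs_neg, abs_of_nonneg (by linarith : 0 ≤ m / 2)]
    rw [mul_div_assoc, ← hm]
    ring

open Filter Topology in
lemma eventually_nonneg_affine {a b : ℝ} (ha : 0 ≤ a) (h : a = 0 → b = 0) :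
    ∀ᶠ ε in 𝓝 (0 : ℝ), 0 ≤ a + ε * b := by
  rcases ha.eq_or_lt with h0 | h0
  · simp [← h0, h h0.symm]
  · have hc : Continuous fun ε : ℝ => a + ε * b := by fun_prop
    have : ∀ᶠ ε in 𝓝 (0 : ℝ), 0 < a + ε * b :=
      hc.continuousAt.eventually (lt_mem_nhds (by simpa using h0))
    exact this.mono fun _ => le_of_lt

/-- Moment vectors that satisfy positivity on edges and all cyclic inequalities. -/
def cyclicRegion (N : ℕ) : Set ((Fin N → ℝ) × (Fin N → ℝ)) :=
  {p | EdgePositive p.1 p.2 ∧ ∀ σ, OddPattern σ → 1 ≤ defect p.2 σ}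

/-- Moment vectors of probability distributions on the outcomes of the nodes. -/
def couplingBody (N : ℕ) : Set ((Fin N → ℝ) × (Fin N → ℝ)) :=
  (fun w => (fun j => ∑ x, w x * sgn (x j),
    fun j => ∑ x, w x * (sgn (x j) * sgn (x (fsucc j))))) '' stdSimplex ℝ (Fin N → Bool)

lemma mem_couplingBody {N : ℕ} {p : (Fin N → ℝ) × (Fin N → ℝ)} :
    p ∈ couplingBody N ↔ ∃ w, (∀ x, 0 ≤ w x) ∧ HasMoments p.1 p.2 w := by
  constructor
  · rintro ⟨w, ⟨h0, h1⟩, rfl⟩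
    exact ⟨w, h0, h1, fun _ => rfl, fun _ => rfl⟩
  · rintro ⟨w, h0, h1, h2, h3⟩
    exact ⟨w, ⟨h0, h1⟩, Prod.ext (funext h2) (funext h3)⟩

lemma isCompact_couplingBody (N : ℕ) : IsCompact (couplingBody N) :=
  (isCompact_stdSimplex ℝ (Fin N → Bool)).image (by fun_prop)

lemma convex_couplingBody (N : ℕ) : Convex ℝ (couplingBody N) := by
  refine (convex_stdSimplex ℝ (Fin N → Bool)).is_linear_image ⟨fun u v => ?_, fun c u => ?_⟩
  · ext j <;> simp [add_mul, sum_add_distrib]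
  · ext j <;> simp [mul_sum, mul_assoc]

lemma convex_cyclicRegion (N : ℕ) : Convex ℝ (cyclicRegion N) := by
  rintro p ⟨hp, hp'⟩ q ⟨hq, hq'⟩ a b ha hb hab
  refine ⟨fun j r r' => ?_, fun σ hσ => ?_⟩
  · have e : edgeForm (a • p + b • q).1 (a • p + b • q).2 j r r'
        = a * edgeForm p.1 p.2 j r r' + b * edgeForm q.1 q.2 j r r' := by
      simp only [edgeForm, Prod.fst_add, Prod.snd_add, Prod.smul_fst, Prod.smul_snd,
        Pi.add_apply, Pi.smul_apply, smul_eq_mul]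
      linear_combination -hab
    rw [e]
    exact add_nonneg (mul_nonneg ha (hp j r r')) (mul_nonneg hb (hq j r r'))
  · have e : defect (a • p + b • q).2 σ = a * defect p.2 σ + b * defect q.2 σ := by
      simp only [defect, mul_sum, ← sum_add_distrib]
      refine sum_congr rfl fun j _ => ?_
      simp only [Prod.snd_add, Prod.smul_snd, Pi.add_apply, Pi.smul_apply, smul_eq_mul]
      linear_combination -hab / 2
    rw [e]
    nlinarith [mul_le_mul_of_nonneg_left (hp' σ hσ) ha, mul_le_mul_of_nonneg_left (hq' σ hσ) hb]

lemma EdgePositive.abs_le {N : ℕ} {M C : Fin N → ℝ} (h : EdgePositive M C) (j : Fin N) :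
    (-1 ≤ M j ∧ M j ≤ 1) ∧ -1 ≤ C j ∧ C j ≤ 1 := by
  have h1 := h j true true
  have h2 := h j true false
  have h3 := h j false true
  have h4 := h j false false
  simp only [edgeForm, sgn_true, sgn_false] at h1 h2 h3 h4
  refine ⟨⟨?_, ?_⟩, ?_, ?_⟩ <;> linarith

lemma isCompact_cyclicRegion (N : ℕ) : IsCompact (cyclicRegion N) := by
  refine IsCompact.of_isClosed_subset
    (isCompact_Icc (a := ((fun _ => -1, fun _ => -1) : (Fin N → ℝ) × (Fin N → ℝ)))
      (b := (fun _ => 1, fun _ => 1))) ?_ ?_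
  · have : cyclicRegion N = (⋂ j, ⋂ r, ⋂ r', {p | 0 ≤ edgeForm p.1 p.2 j r r'})
        ∩ ⋂ σ, ⋂ _ : OddPattern σ, {p | 1 ≤ defect p.2 σ} := by
      ext p; simp [cyclicRegion, EdgePositive]
    rw [this]
    refine IsClosed.inter ?_ ?_
    · refine isClosed_iInter fun j => isClosed_iInter fun r => isClosed_iInter fun r' => ?_
      exact isClosed_le continuous_const (by unfold edgeForm; fun_prop)
    · refine isClosed_iInter fun σ => isClosed_iInter fun _ => ?_
      exact isClosed_le continuous_const (by unfold defect; fun_prop)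
  · rintro p ⟨hp, -⟩
    exact ⟨⟨fun j => (hp.abs_le j).1.1, fun j => (hp.abs_le j).2.1⟩,
      fun j => (hp.abs_le j).1.2, fun j => (hp.abs_le j).2.2⟩

/-- The derivative of `edgeForm` in the direction `(h, H)`. -/
def edgeSlope {N : ℕ} (h H : Fin N → ℝ) (j : Fin N) (r r' : Bool) : ℝ :=
  sgn r * h j + sgn r' * h (fsucc j) + sgn r * sgn r' * H j

open Filter Topology in
/-- At an extreme point where no cyclic inequality is tight, the tight positivity constraints
admit no nontrivial perturbation. -/
lemma eq_zero_of_mem_extremePoints {N : ℕ} {p : (Fin N → ℝ) × (Fin N → ℝ)}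
    (hp : p ∈ (cyclicRegion N).extremePoints ℝ) (hs : ∀ σ, OddPattern σ → 1 < defect p.2 σ)
    (q : (Fin N → ℝ) × (Fin N → ℝ))
    (hq : ∀ j r r', edgeForm p.1 p.2 j r r' = 0 → edgeSlope q.1 q.2 j r r' = 0) : q = 0 := by
  rw [mem_extremePoints] at hp
  have hev : ∀ᶠ ε in 𝓝 (0 : ℝ), p + ε • q ∈ cyclicRegion N := by
    have h1 : ∀ᶠ ε in 𝓝 (0 : ℝ), ∀ j r r',
        0 ≤ edgeForm p.1 p.2 j r r' + ε * edgeSlope q.1 q.2 j r r' := by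
      simp only [eventually_all]
      exact fun j r r' => eventually_nonneg_affine (hp.1.1 j r r') (hq j r r')
    have h2 : ∀ᶠ ε in 𝓝 (0 : ℝ), ∀ σ, OddPattern σ → 1 < defect (p + ε • q).2 σ := by
      simp only [eventually_all]
      intro σ hσ
      have hc : Continuous fun ε : ℝ => defect (p + ε • q).2 σ := by unfold defect; fun_prop
      exact hc.continuousAt.eventually (lt_mem_nhds (by simpa using hs σ hσ))
    filter_upwards [h1, h2] with ε h1 h2
    refine ⟨fun j r r' => ?_, fun σ hσ => (h2 σ hσ).le⟩
    convert h1 j r r' using 1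
    simp only [edgeForm, edgeSlope, Prod.fst_add, Prod.snd_add, Prod.smul_fst, Prod.smul_snd,
      Pi.add_apply, Pi.smul_apply, smul_eq_mul]
    ring
  have hev' : ∀ᶠ ε in 𝓝 (0 : ℝ), p + (-ε) • q ∈ cyclicRegion N := by
    have := (continuous_neg.tendsto (0 : ℝ))
    rw [neg_zero] at this
    exact this.eventually hev
  obtain ⟨δ, ⟨hδ1, hδ2⟩, hδ⟩ :=
    (((hev.and hev').filter_mono nhdsWithin_le_nhds).and (self_mem_nhdsWithin (s := Set.Ioi 0))).exists
  have hδ0 : (0 : ℝ) < δ := hδ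
  have := (hp.2 _ hδ1 _ hδ2 ⟨1 / 2, 1 / 2, by norm_num, by norm_num, by norm_num, by module⟩).1
  have h0 : δ • q = 0 := by simpa using this
  exact (smul_eq_zero.1 h0).resolve_left hδ0.ne'

lemma exists_potential_of_prod_eq_one {N : ℕ} {σ : Fin N → Bool} (hσ : ∏ j, sgn (σ j) = 1) :
    ∃ θ : Fin N → Bool, ∀ j, θ (fsucc j) = xor (θ j) (σ j) := by
  obtain ⟨θ, hθ0, hθs, hθN⟩ := exists_potential σ
  refine ⟨fun j => θ j, fun j => ?_⟩
  simp only [fsucc_val]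
  split_ifs with h
  · rw [← hθs, h, hθ0]
    rw [hσ] at hθN
    cases hb : θ N
    · rfl
    · rw [hb] at hθN; norm_num at hθN
  · exact hθs j

lemma deterministic_mem_couplingBody {N : ℕ} {p : (Fin N → ℝ) × (Fin N → ℝ)}
    (hp : EdgePositive p.1 p.2) (h : ∀ j, p.1 j = 1 ∨ p.1 j = -1) : p ∈ couplingBody N := by
  have hx : ∀ j, ∃ b, sgn b = p.1 j := fun j => by
    rcases h j with h | h
    · exact ⟨false, by simp [h]⟩
    · exact ⟨true, by simp [h]⟩
  choose x hx using hx
  refine mem_couplingBody.2 ⟨fun y => if y = x then 1 else 0, fun y => by positivity, ?_, ?_, ?_⟩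
  · simp
  · simp [hx]
  · intro j
    have h1 := hp j true true
    have h2 := hp j true false
    have h3 := hp j false true
    have h4 := hp j false false
    simp only [edgeForm, sgn_true, sgn_false] at h1 h2 h3 h4
    simp only [ite_mul, one_mul, zero_mul, sum_ite_eq', mem_univ, if_true, hx]
    rcases h j with hj | hj <;> rcases h (fsucc j) with hj' | hj' <;>
      rw [hj, hj'] at h1 h2 h3 h4 ⊢ <;> linarith

/-- If `(t, t')` is tight and the correlation moves so as to keep it tight, then any other tight
constraint of the same edge stays tight, provided that `±1` expectations stay fixed and
`x = ∓y` is preserved. -/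
lemma tight_slope_eq_zero {x y c u v : ℝ} {t t' s s' : Bool}
    (ht : 1 + sgn t * x + sgn t' * y + sgn t * sgn t' * c = 0)
    (hs : 1 + sgn s * x + sgn s' * y + sgn s * sgn s' * c = 0)
    (hx : x = 1 ∨ x = -1 → u = 0) (hy : y = 1 ∨ y = -1 → v = 0)
    (hxy : sgn t * x + sgn t' * y = 0 → sgn t * u + sgn t' * v = 0) :
    sgn s * u + sgn s' * v + sgn s * sgn s' * (-(sgn t * sgn t') * (sgn t * u + sgn t' * v))
      = 0 := by
  have flip : ∀ {a b : Bool}, a ≠ b → sgn a = -sgn b := by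
    intro a b h
    cases a <;> cases b <;> simp at h ⊢
  have unit : ∀ {a : Bool} {z : ℝ}, 1 + sgn a * z = 0 → z = 1 ∨ z = -1 := by
    intro a z h
    cases a <;> simp only [sgn_true, sgn_false] at h
    · right; linarith
    · left; linarith
  have e1 := sgn_mul_self t
  have e2 := sgn_mul_self t'
  by_cases e : s = t <;> by_cases e' : s' = t'
  · subst e e'
    linear_combination (-(sgn s * u + sgn s' * v)) * (sgn s' * sgn s' * e1 + e2)
  · subst e
    rw [flip e'] at hs ⊢
    rw [hx (unit (a := s) (by linarith))]
    linear_combination (sgn t' * v) * (sgn t' * sgn t' * e1 + e2)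
  · subst e'
    rw [flip e] at hs ⊢
    rw [hy (unit (a := s') (by linarith))]
    linear_combination (sgn t * u) * (sgn s' * sgn s' * e1 + e2)
  · rw [flip e, flip e'] at hs ⊢
    linear_combination (-1 - sgn t * sgn t' * (sgn t * sgn t')) * hxy (by linarith)

/-- Extreme points of the cyclic region are realized by probability distributions. -/
lemma extremePoints_subset_couplingBody {N : ℕ} (hN : Even N) (hN4 : 4 ≤ N) :
    (cyclicRegion N).extremePoints ℝ ⊆ couplingBody N := by
  intro p hp
  have hR := hp.1
  by_cases hs : ∃ σ, OddPattern σ ∧ defect p.2 σ = 1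
  · obtain ⟨σ, hσ, hd⟩ := hs
    obtain ⟨w, hw, hle⟩ := exists_hasMoments_sum_abs_le hN hN4 hR.1 hσ hd.le
    refine mem_couplingBody.2 ⟨w, ?_, hw⟩
    have h0 : ∑ x, (|w x| - w x) ≤ 0 := by
      rw [sum_sub_distrib, hw.1]
      rw [hd] at hle
      simpa using hle
    intro x
    have := single_le_sum (f := fun x => |w x| - w x)
      (fun y _ => sub_nonneg.2 (le_abs_self (w y))) (mem_univ x)
    have h1 := abs_nonneg (w x)
    linarith
  replace hs : ∀ σ, OddPattern σ → 1 < defect p.2 σ := fun σ hσ =>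
    lt_of_le_of_ne (hR.2 σ hσ) fun h => hs ⟨σ, hσ, h.symm⟩
  obtain ⟨M, C⟩ := p
  have hzero := eq_zero_of_mem_extremePoints hp hs
  have hQ : EdgePositive M C := hR.1
  have htight : ∀ j, ∃ r r', edgeForm M C j r r' = 0 := by
    intro j
    by_contra! hne
    have := hzero (0, Pi.single j 1) fun i r r' h => by
      have hij : i ≠ j := fun e => hne r r' (e ▸ h)
      simp [edgeSlope, hij]
    have := congrFun (congrArg Prod.snd this) j
    simp at this
  choose r r' hr using htight
  have hperturb : ∀ h : Fin N → ℝ, (∀ j, M j = 1 ∨ M j = -1 → h j = 0) →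
      (∀ j, sgn (r j) * M j + sgn (r' j) * M (fsucc j) = 0 →
        sgn (r j) * h j + sgn (r' j) * h (fsucc j) = 0) → h = 0 := by
    intro h h1 h2
    have := hzero (h, fun j => -(sgn (r j) * sgn (r' j))
      * (sgn (r j) * h j + sgn (r' j) * h (fsucc j))) fun j s s' hss => by
        exact tight_slope_eq_zero (hr j) hss (h1 j) (h1 (fsucc j)) (h2 j)
    exact congrArg Prod.fst this
  have hM : ∀ i, M i = 0 ∨ M i = 1 ∨ M i = -1 := by
    intro i
    by_contra! hi
    have := hperturb (fun j => if |M j| = |M i| then M j else 0)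
      (fun j hj => by
        refine if_neg fun h => ?_
        have h1 : |M j| = 1 := by rcases hj with hj | hj <;> simp [hj]
        rw [h1, eq_comm, abs_eq zero_le_one] at h
        rcases h with h | h
        · exact hi.2.1 h
        · exact hi.2.2 h)
      (fun j hj => by
        have : |M (fsucc j)| = |M j| := by
          rw [abs_eq_abs]
          revert hj
          cases r j <;> cases r' j <;> simp only [sgn_true, sgn_false] <;> intro hj
          all_goals first | (left; linarith) | (right; linarith)
        simp only [this]
        split_ifs
        · exact hj
        · simp)
    have := congrFun this i
    simp at this
    exact hi.1 this
  by_cases hall : ∀ j, M j ≠ 0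
  · exact deterministic_mem_couplingBody hQ fun j => (hM j).resolve_left (hall j)
  exfalso
  push Not at hall
  obtain ⟨i, hi⟩ := hall
  let σ : Fin N → Bool := fun j => !(xor (r j) (r' j))
  have hσ' : ∀ j, sgn (σ j) = - (sgn (r j) * sgn (r' j)) := fun j => by
    simp only [σ]
    cases r j <;> cases r' j <;> simp
  obtain ⟨τ, hτ, hτσ⟩ : ∃ τ : Fin N → Bool, ∏ j, sgn (τ j) = 1 ∧ ∀ j, M j = 0 → τ j = σ j := by
    have hsq : ∀ υ : Fin N → Bool, ∏ j, sgn (υ j) = 1 ∨ ∏ j, sgn (υ j) = -1 := fun υ => by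
      rw [← mul_self_eq_one_iff, ← prod_mul_distrib]
      simp
    rcases hsq σ with h | h
    · exact ⟨σ, h, fun _ _ => rfl⟩
    by_cases hk : ∃ k, M k ≠ 0
    · obtain ⟨k, hk⟩ := hk
      refine ⟨Function.update σ k (!σ k), ?_, fun j hj => ?_⟩
      · have e : ∀ j, sgn (Function.update σ k (!σ k) j) = sgn (σ j) * if j = k then -1 else 1 := by
          intro j
          by_cases hj : j = k
          · subst hj; cases σ j <;> simp
          · simp [hj]
        simp only [e, prod_mul_distrib, h, prod_ite_eq', mem_univ, if_true]
        norm_num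
      · exact Function.update_of_ne (by rintro rfl; exact hk hj) _ _
    · push Not at hk
      exfalso
      have := hs σ h
      have h0 : defect C σ = 0 := sum_eq_zero fun j _ => by
        have := hr j
        simp only [edgeForm, hk] at this
        rw [hσ']
        linarith
      linarith
  obtain ⟨θ, hθ⟩ := exists_potential_of_prod_eq_one hτ
  have := hperturb (fun j => if M j = 0 then sgn (θ j) else 0)
    (fun j hj => if_neg (by rcases hj with hj | hj <;> rw [hj] <;> norm_num))
    (fun j hj => by
      by_cases h0 : M j = 0
      · have h1 : M (fsucc j) = 0 := by
          rw [h0] at hj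
          simpa [sgn_ne_zero] using hj
        simp only [h0, h1, if_true, hθ, hτσ j h0, sgn_xor, hσ']
        linear_combination (-(sgn (r j) * sgn (θ j))) * sgn_mul_self (r' j)
      · have h1 : M (fsucc j) ≠ 0 := fun h1 => by
          rw [h1] at hj
          simp [sgn_ne_zero, h0] at hj
        simp [h0, h1])
  have := congrFun this i
  simp [hi, sgn_ne_zero] at this

/-- The cyclic inequalities suffice for the existence of a coupling. -/
lemma exists_nonneg_hasMoments {N : ℕ} (hN : Even N) (hN4 : 4 ≤ N) {M C : Fin N → ℝ}
    (hQ : EdgePositive M C) (hs : ∀ σ, OddPattern σ → 1 ≤ defect C σ) :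
    ∃ w, (∀ x, 0 ≤ w x) ∧ HasMoments M C w := by
  have hmem : (M, C) ∈ cyclicRegion N := ⟨hQ, hs⟩
  rw [← closure_convexHull_extremePoints (isCompact_cyclicRegion N) (convex_cyclicRegion N)] at hmem
  exact mem_couplingBody.1 (closure_minimal
    (convexHull_min (extremePoints_subset_couplingBody hN hN4) (convex_couplingBody N))
    (isCompact_couplingBody N).isClosed hmem)

/-- Every node has the same marginal in both edges containing it. -/
def ConsistentlyConnected {N : ℕ} (e : Fin N → Bool → Bool → ℝ) : Prop :=
  ∀ j r, mFst e j r = mSnd e j r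

/-- Expectation of the first node of an edge. -/
def nodeMean {N : ℕ} (e : Fin N → Bool → Bool → ℝ) (j : Fin N) : ℝ :=
  mFst e j false - mFst e j true

/-- Correlation of an edge. -/
def edgeCorr {N : ℕ} (e : Fin N → Bool → Bool → ℝ) (j : Fin N) : ℝ :=
  e j false false + e j true true - e j false true - e j true false

lemma edgeForm_moments {N : ℕ} {e : Fin N → Bool → Bool → ℝ} (he : IsCyclicSystem N e)
    (hc : ConsistentlyConnected e) (j : Fin N) (r r' : Bool) :
    edgeForm (nodeMean e) (edgeCorr e) j r r' = 4 * e j r r' := by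
  have h1 := he.2 j
  have h2 := hc (fsucc j) false
  have h3 := hc (fsucc j) true
  simp only [Fintype.sum_bool] at h1
  simp only [mFst, mSnd, fpred_fsucc] at h2 h3
  simp only [edgeForm, nodeMean, edgeCorr, mFst]
  cases r <;> cases r' <;> simp only [sgn_true, sgn_false] <;> linarith

lemma edgePositive_moments {N : ℕ} {e : Fin N → Bool → Bool → ℝ} (he : IsCyclicSystem N e)
    (hc : ConsistentlyConnected e) : EdgePositive (nodeMean e) (edgeCorr e) := fun j r r' => by
  rw [edgeForm_moments he hc]
  linarith [he.1 j r r']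

/-- Marginal of a signed measure on the edge `j`. -/
def edgeMarginal {N : ℕ} (j : Fin N) (w : (Fin N → Bool) → ℝ) (r r' : Bool) : ℝ :=
  ∑ x : Fin N → Bool, if x j = r ∧ x (fsucc j) = r' then w x else 0

lemma four_mul_edgeMarginal {N : ℕ} (j : Fin N) (w : (Fin N → Bool) → ℝ) (r r' : Bool) :
    4 * edgeMarginal j w r r' = ∑ x, w x + sgn r * ∑ x, w x * sgn (x j)
      + sgn r' * ∑ x, w x * sgn (x (fsucc j))
      + sgn r * sgn r' * ∑ x, w x * (sgn (x j) * sgn (x (fsucc j))) := by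
  simp only [edgeMarginal, mul_sum, ← sum_add_distrib]
  refine sum_congr rfl fun x _ => ?_
  cases x j <;> cases x (fsucc j) <;> cases r <;> cases r' <;> simp <;> ring

lemma hasMoments_iff_edgeMarginal {N : ℕ} (hN : 0 < N) {e : Fin N → Bool → Bool → ℝ}
    (he : IsCyclicSystem N e) (hc : ConsistentlyConnected e) (w : (Fin N → Bool) → ℝ) :
    HasMoments (nodeMean e) (edgeCorr e) w ↔ ∀ j r r', edgeMarginal j w r r' = e j r r' := by
  constructor
  · rintro ⟨h1, h2, h3⟩ j r r'
    have := four_mul_edgeMarginal j w r r'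
    have h := edgeForm_moments he hc j r r'
    rw [h1, h2, h2, h3] at this
    rw [edgeForm] at h
    linarith
  · intro h
    have key := fun j r r' => (congrArg (4 * ·) (h j r r')).symm.trans (four_mul_edgeMarginal j w r r')
    refine ⟨?_, fun j => ?_, fun j => ?_⟩
    · have h0 := he.2 ⟨0, hN⟩
      simp only [Fintype.sum_bool] at h0
      have k1 := key ⟨0, hN⟩ true true
      have k2 := key ⟨0, hN⟩ true false
      have k3 := key ⟨0, hN⟩ false true
      have k4 := key ⟨0, hN⟩ false false
      simp only [sgn_true, sgn_false] at k1 k2 k3 k4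
      linarith
    all_goals
      have k1 := key j true true
      have k2 := key j true false
      have k3 := key j false true
      have k4 := key j false false
      simp only [sgn_true, sgn_false] at k1 k2 k3 k4
      simp only [nodeMean, mFst, edgeCorr]
      linarith

lemma mFst_add {n : ℕ} {b : Fin n → Bool → Bool → ℝ} (hb : IsCyclicSystem n b) (i : Fin n) :
    mFst b i true + mFst b i false = 1 := by
  have := hb.2 i
  simp only [Fintype.sum_bool] at this
  simp only [mFst]
  linarith

lemma mSnd_add {n : ℕ} {b : Fin n → Bool → Bool → ℝ} (hb : IsCyclicSystem n b) (i : Fin n) :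
    mSnd b i true + mSnd b i false = 1 := by
  have := hb.2 (fpred i)
  simp only [Fintype.sum_bool] at this
  simp only [mSnd]
  linarith

lemma mmc_nonneg {n : ℕ} {b : Fin n → Bool → Bool → ℝ} (hb : IsCyclicSystem n b) (i : Fin n)
    (r r' : Bool) : 0 ≤ mmc b i r r' := by
  have h1 : ∀ r, 0 ≤ mFst b i r := fun r => add_nonneg (hb.1 _ _ _) (hb.1 _ _ _)
  have h2 : ∀ r, 0 ≤ mSnd b i r := fun r => add_nonneg (hb.1 _ _ _) (hb.1 _ _ _)
  cases r <;> cases r' <;> simp only [mmc]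
  · exact le_min (h1 _) (h2 _)
  · exact sub_nonneg.2 (min_le_right _ _)
  · exact sub_nonneg.2 (min_le_left _ _)
  · exact le_min (h1 _) (h2 _)

lemma mmc_fst {n : ℕ} {b : Fin n → Bool → Bool → ℝ} (hb : IsCyclicSystem n b) (i : Fin n)
    (r : Bool) : mmc b i r false + mmc b i r true = mFst b i r := by
  have h1 := mFst_add hb i
  have h2 := mSnd_add hb i
  cases r <;> simp only [mmc]
  · rcases le_total (mFst b i true) (mSnd b i true) with h | h
    · rw [min_eq_left h, min_eq_right (by linarith)]; linarith
    · rw [min_eq_right h, min_eq_left (by linarith)]; linarith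
  · linarith

lemma mmc_snd {n : ℕ} {b : Fin n → Bool → Bool → ℝ} (hb : IsCyclicSystem n b) (i : Fin n)
    (r : Bool) : mmc b i false r + mmc b i true r = mSnd b i r := by
  have h1 := mFst_add hb i
  have h2 := mSnd_add hb i
  cases r <;> simp only [mmc]
  · rcases le_total (mFst b i true) (mSnd b i true) with h | h
    · rw [min_eq_left h, min_eq_right (by linarith)]; linarith
    · rw [min_eq_right h, min_eq_left (by linarith)]; linarith
  · linarith

/-- The even node `2i` of the doubled cycle. -/
def evenNode {n : ℕ} (i : Fin n) : Fin (2 * n) := ⟨2 * i, by have := i.isLt; omega⟩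

/-- The odd node `2i + 1` of the doubled cycle. -/
def oddNode {n : ℕ} (i : Fin n) : Fin (2 * n) := ⟨2 * i + 1, by have := i.isLt; omega⟩

lemma eq_evenNode_or_oddNode {n : ℕ} (j : Fin (2 * n)) :
    ∃ i, j = evenNode i ∨ j = oddNode i := by
  have := j.isLt
  refine ⟨⟨j / 2, by omega⟩, ?_⟩
  simp only [evenNode, oddNode, Fin.ext_iff]
  omega

@[simp] lemma fsucc_evenNode {n : ℕ} (i : Fin n) : fsucc (evenNode i) = oddNode i := by
  have := i.isLt
  ext
  simp only [fsucc_val, evenNode, oddNode]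
  rw [if_neg (by omega)]

@[simp] lemma fsucc_oddNode {n : ℕ} (i : Fin n) : fsucc (oddNode i) = evenNode (fsucc i) := by
  have := i.isLt
  ext
  simp only [fsucc_val, evenNode, oddNode]
  split_ifs <;> omega

@[simp] lemma fpred_oddNode {n : ℕ} (i : Fin n) : fpred (oddNode i) = evenNode i := by
  rw [← fsucc_evenNode, fpred_fsucc]

lemma fpred_evenNode {n : ℕ} (i : Fin n) : fpred (evenNode i) = oddNode (fpred i) := by
  conv_lhs => rw [← fsucc_fpred i, ← fsucc_oddNode, fpred_fsucc]

@[simp] lemma consistify_evenNode {n : ℕ} (b : Fin n → Bool → Bool → ℝ) (i : Fin n)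
    (r r' : Bool) : consistify n b (evenNode i) r r' = b i r r' := by
  simp [consistify, evenNode]

@[simp] lemma consistify_oddNode {n : ℕ} (b : Fin n → Bool → Bool → ℝ) (i : Fin n)
    (r r' : Bool) : consistify n b (oddNode i) r r' = mmc b (fsucc i) r' r := by
  have : (2 * i.val + 1) / 2 = i := by omega
  simp [consistify, oddNode, this, Nat.add_mod]

lemma isCyclicSystem_consistify {n : ℕ} {b : Fin n → Bool → Bool → ℝ}
    (hb : IsCyclicSystem n b) : IsCyclicSystem (2 * n) (consistify n b) := by
  constructor
  · intro j r r'
    obtain ⟨i, rfl | rfl⟩ := eq_evenNode_or_oddNode j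
    · simpa using hb.1 i r r'
    · simpa using mmc_nonneg hb (fsucc i) r' r
  · intro j
    obtain ⟨i, rfl | rfl⟩ := eq_evenNode_or_oddNode j
    · simpa using hb.2 i
    · have h1 := mmc_fst hb (fsucc i) true
      have h2 := mmc_fst hb (fsucc i) false
      have := mFst_add hb (fsucc i)
      simp only [Fintype.sum_bool, consistify_oddNode]
      linarith

lemma consistentlyConnected_consistify {n : ℕ} {b : Fin n → Bool → Bool → ℝ}
    (hb : IsCyclicSystem n b) : ConsistentlyConnected (consistify n b) := by
  intro j r
  obtain ⟨i, rfl | rfl⟩ := eq_evenNode_or_oddNode j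
  · simpa [mFst, mSnd, fpred_evenNode] using (mmc_fst hb i r).symm
  · simpa [mFst, mSnd] using mmc_snd hb (fsucc i) r

/-- The joint states of a cyclic system as outcomes of the nodes of the doubled cycle. -/
def stateEquiv (n : ℕ) : (Fin n → Bool × Bool) ≃ (Fin (2 * n) → Bool) where
  toFun s j := if j.val % 2 = 0 then (s ⟨j / 2, by have := j.isLt; omega⟩).1
    else (s ⟨j / 2, by have := j.isLt; omega⟩).2
  invFun x i := (x (evenNode i), x (oddNode i))
  left_inv s := by
    ext i
    · simp [evenNode]
    · have : (2 * i.val + 1) / 2 = i := by omega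
      simp [oddNode, this, Nat.add_mod]
  right_inv x := by
    ext j
    have hj := Nat.div_add_mod j.val 2
    by_cases h : j.val % 2 = 0
    · have e : evenNode ⟨j / 2, by have := j.isLt; omega⟩ = j := by
        ext; simp only [evenNode]; omega
      simp [h, e]
    · have e : oddNode ⟨j / 2, by have := j.isLt; omega⟩ = j := by
        ext; simp only [oddNode]; omega
      simp [h, e]

@[simp] lemma stateEquiv_evenNode {n : ℕ} (s : Fin n → Bool × Bool) (i : Fin n) :
    stateEquiv n s (evenNode i) = (s i).1 :=
  congrArg Prod.fst (congrFun ((stateEquiv n).left_inv s) i)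

@[simp] lemma stateEquiv_oddNode {n : ℕ} (s : Fin n → Bool × Bool) (i : Fin n) :
    stateEquiv n s (oddNode i) = (s i).2 :=
  congrArg Prod.snd (congrFun ((stateEquiv n).left_inv s) i)

lemma feasible_iff_hasMoments {n : ℕ} (hn : 0 < n) {b : Fin n → Bool → Bool → ℝ}
    (hb : IsCyclicSystem n b) (w : (Fin (2 * n) → Bool) → ℝ) :
    Feasible b (w ∘ stateEquiv n)
      ↔ HasMoments (nodeMean (consistify n b)) (edgeCorr (consistify n b)) w := by
  rw [hasMoments_iff_edgeMarginal (by omega) (isCyclicSystem_consistify hb)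
    (consistentlyConnected_consistify hb)]
  have hB : ∀ i r r', edgeMarginal (evenNode i) w r r' = Bm i (w ∘ stateEquiv n) r r' := by
    intro i r r'
    rw [edgeMarginal, ← (stateEquiv n).sum_comp]
    simp [Bm, Prod.ext_iff]
  have hC : ∀ i r r', edgeMarginal (oddNode i) w r r' = Cm (fsucc i) (w ∘ stateEquiv n) r' r := by
    intro i r r'
    rw [edgeMarginal, ← (stateEquiv n).sum_comp]
    simp [Cm, and_comm]
  constructor
  · intro h j r r'
    obtain ⟨i, rfl | rfl⟩ := eq_evenNode_or_oddNode j
    · rw [hB, consistify_evenNode, (h i r r').1]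
    · rw [hC, consistify_oddNode, (h (fsucc i) r' r).2]
  · intro h i r r'
    refine ⟨?_, ?_⟩
    · rw [← hB, h, consistify_evenNode]
    · have := hC (fpred i) r' r
      rw [fsucc_fpred] at this
      rw [← this, h, consistify_oddNode, fsucc_fpred]

/-- `CNT3` in terms of the violation of a cyclic inequality. -/
lemma cnt3_eq_of_defect_le_one {n : ℕ} (hn : 2 ≤ n) {b : Fin n → Bool → Bool → ℝ}
    (hb : IsCyclicSystem n b) {σ : Fin (2 * n) → Bool} (hσ : OddPattern σ)
    (hd : defect (edgeCorr (consistify n b)) σ ≤ 1) :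
    CNT3 b = (1 - defect (edgeCorr (consistify n b)) σ) / ((n : ℝ) - 1) := by
  have hnR : (2 : ℝ) ≤ n := by exact_mod_cast hn
  have hn1 : (n : ℝ) - 1 ≠ 0 := by linarith
  set δ := defect (edgeCorr (consistify n b)) σ with hδ
  have hlb : ∀ w, HasMoments (nodeMean (consistify n b)) (edgeCorr (consistify n b)) w →
      1 + (1 - δ) / ((n : ℝ) - 1) ≤ ∑ x, |w x| := by
    intro w hw
    have := hw.le_sum_abs (even_two_mul n) hσ
    push_cast at this
    have h2 : 1 + (1 - δ) / ((n : ℝ) - 1) = (n - δ) / ((n : ℝ) - 1) := by field_simp; ring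
    rw [h2, div_le_iff₀ (by linarith)]
    linarith
  obtain ⟨w, hw, hle⟩ := exists_hasMoments_sum_abs_le (even_two_mul n) (by omega)
    (edgePositive_moments (isCyclicSystem_consistify hb) (consistentlyConnected_consistify hb))
    hσ hd
  have hle' : ∑ x, |w x| ≤ 1 + (1 - δ) / ((n : ℝ) - 1) := by
    refine hle.trans (le_of_eq ?_)
    push_cast
    rw [show 2 * (n : ℝ) - 2 = 2 * (n - 1) by ring, mul_div_mul_left _ _ two_ne_zero]
  have hleast : IsLeast {t : ℝ | ∃ y, Feasible b y ∧ t = ∑ s : Fin n → Bool × Bool, |y s|}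
      (1 + (1 - δ) / ((n : ℝ) - 1)) := by
    constructor
    · refine ⟨w ∘ stateEquiv n, (feasible_iff_hasMoments (by omega) hb w).2 hw, ?_⟩
      rw [← le_antisymm hle' (hlb w hw), ← (stateEquiv n).sum_comp]
      rfl
    · rintro t ⟨y, hy, rfl⟩
      have hy' : y = (y ∘ (stateEquiv n).symm) ∘ stateEquiv n := by ext; simp
      rw [hy'] at hy
      refine (hlb _ ((feasible_iff_hasMoments (by omega) hb _).1 hy)).trans (le_of_eq ?_)
      rw [← (stateEquiv n).sum_comp]
      simp
  rw [CNT3, hleast.csInf_eq]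
  ring

lemma exists_oddPattern_of_contextual {n : ℕ} (hn : 2 ≤ n) {b : Fin n → Bool → Bool → ℝ}
    (hb : IsCyclicSystem n b) (hctx : ¬ Noncontextual b) :
    ∃ σ : Fin (2 * n) → Bool, OddPattern σ ∧ defect (edgeCorr (consistify n b)) σ < 1 := by
  by_contra! h
  obtain ⟨w, hw0, hw⟩ := exists_nonneg_hasMoments (even_two_mul n) (by omega)
    (edgePositive_moments (isCyclicSystem_consistify hb) (consistentlyConnected_consistify hb)) h
  exact hctx ⟨_, (feasible_iff_hasMoments (by omega) hb w).2 hw, fun s => hw0 _⟩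

lemma univ_prod_evenNode_oddNode {n : ℕ} {α : Type*} [CommMonoid α] (f : Fin (2 * n) → α) :
    ∏ j, f j = ∏ i, f (evenNode i) * f (oddNode i) := by
  induction n with
  | zero => rfl
  | succ n ih =>
    rw [Fin.prod_univ_castSucc]
    have h1 : ∏ j, f j = (∏ j : Fin (2 * n + 1), f j.castSucc) * f (Fin.last (2 * n + 1)) :=
      Fin.prod_univ_castSucc (n := 2 * n + 1) f
    have h2 : ∏ j : Fin (2 * n + 1), f j.castSucc
        = (∏ j : Fin (2 * n), f j.castSucc.castSucc) * f (Fin.last (2 * n)).castSucc :=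
      Fin.prod_univ_castSucc (n := 2 * n) fun j => f j.castSucc
    rw [h1, h2, ih, mul_assoc]
    rfl

lemma univ_sum_evenNode_oddNode {n : ℕ} (f : Fin (2 * n) → ℝ) :
    ∑ j, f j = ∑ i, (f (evenNode i) + f (oddNode i)) :=
  univ_prod_evenNode_oddNode (α := Multiplicative ℝ) f

/-- Consistification of a consistently connected system adds no defect. -/
lemma exists_oddPattern_consistify {N : ℕ} {e : Fin N → Bool → Bool → ℝ}
    (he : IsCyclicSystem N e) (hc : ConsistentlyConnected e) {σ : Fin N → Bool}
    (hσ : OddPattern σ) :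
    ∃ τ : Fin (2 * N) → Bool, OddPattern τ ∧
      defect (edgeCorr (consistify N e)) τ = defect (edgeCorr e) σ := by
  let τ : Fin (2 * N) → Bool := fun j =>
    if j.val % 2 = 0 then σ ⟨j / 2, by have := j.isLt; omega⟩ else false
  have h0 : ∀ i, τ (evenNode i) = σ i := fun i => by simp [τ, evenNode]
  have h1 : ∀ i, τ (oddNode i) = false := fun i => by simp [τ, oddNode, Nat.add_mod]
  refine ⟨τ, ?_, ?_⟩
  · rw [OddPattern, univ_prod_evenNode_oddNode]
    simpa [h0, h1, OddPattern] using hσ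
  · rw [defect, univ_sum_evenNode_oddNode, defect]
    refine sum_congr rfl fun i _ => ?_
    have hodd : edgeCorr (consistify N e) (oddNode i) = 1 := by
      have := mFst_add he (fsucc i)
      simp only [edgeCorr, consistify_oddNode, mmc, ← hc (fsucc i), min_self]
      linarith
    rw [h0, h1, hodd]
    simp [edgeCorr]

end CyclicCoupling

/-- `CNT3` is not invariant under consistification: for a contextual cyclic system `b`
of rank `n ≥ 2`, `CNT3(b‡) = ((n - 1)/(2n - 1)) · CNT3(b)`. -/
theorem cnt3_consistification (n : ℕ) (hn : 2 ≤ n)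
    (b : Fin n → Bool → Bool → ℝ) (hb : IsCyclicSystem n b)
    (hctx : ¬ Noncontextual b) :
    CNT3 (consistify n b) = (((n : ℝ) - 1) / (2 * (n : ℝ) - 1)) * CNT3 b := by
  obtain ⟨σ, hσ, hd⟩ := exists_oddPattern_of_contextual hn hb hctx
  have hb' := isCyclicSystem_consistify hb
  obtain ⟨τ, hτ, hτd⟩ := exists_oddPattern_consistify hb' (consistentlyConnected_consistify hb) hσ
  have hnR : (2 : ℝ) ≤ n := by exact_mod_cast hn
  have h1 : (n : ℝ) - 1 ≠ 0 := by linarith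
  have h2 : 2 * (n : ℝ) - 1 ≠ 0 := by linarith
  rw [cnt3_eq_of_defect_le_one hn hb hσ hd.le,
    cnt3_eq_of_defect_le_one (by omega) hb' hτ (by rw [hτd]; exact hd.le), hτd]
  push_cast
  field_simp
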